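/- Let 0 < r < 1, let m₃ ∈ (1/2, 3/2) be the root of 2rm = (m − 1/2)²(m + 3/2), let Q_r(σ, η) = r(2η² − 3ση) + (9/4)(η − σ/2)², and let R : ℝ² → ℝ be a C^∞ function vanishing to third order at the origin (R(0,0) = 0, DR(0,0) = 0, D²R(0,0) = 0). Define h(σ, η) = (η − σ/2, √(Q_r(σ, η) + R(σ, η))) on the set where Q_r + R ≥ 0. Then there exist ε > 0 and a C¹ function w : [0, ε) → ℝ with w(0) = 0 and w′(0) = m₃ such that the curve β = { (s, w(s)) : s ∈ [0, ε) } is contained in the domain of h, is invariant under h (h(β) ⊆ β), and every point of β converges to the origin under iteration of h. -/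

import Mathlib

open Set Filter Topology

/-- The sector of half-aperture `δ` and length `ε` around the positive first axis. -/
def stableSector (δ ε : ℝ) : Set (ℝ × ℝ) :=
  {p | 0 ≤ p.1 ∧ p.1 ≤ ε ∧ |p.2| ≤ δ * p.1}

/-- `g` is `θ`-Lipschitz on a sector, for the `ℓ¹` distance. -/
def SectorLipschitz (g : ℝ × ℝ → ℝ) (θ δ ε : ℝ) : Prop :=
  ∀ p ∈ stableSector δ ε, ∀ q ∈ stableSector δ ε,
    |g p - g q| ≤ θ * (|p.1 - q.1| + |p.2 - q.2|)

/-- `κ`-Lipschitz functions on `[0, ε]` whose graph lies in the sector of half-aperture `δ`. -/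
def SectorGraph (κ δ ε : ℝ) (u : ℝ → ℝ) : Prop :=
  (∀ x ∈ Icc 0 ε, |u x| ≤ δ * x) ∧ ∀ x ∈ Icc 0 ε, ∀ y ∈ Icc 0 ε, |u x - u y| ≤ κ * |x - y|

/-- The graph transform of the map `(x, y) ↦ (l x + y, μ y + g (x, y))`. -/
noncomputable def graphTransform (l μ : ℝ) (g : ℝ × ℝ → ℝ) (u : ℝ → ℝ) (x : ℝ) : ℝ :=
  (u (l * x + u x) - g (x, u x)) / μ

/-- Smallness conditions on the constants under which the graph transform is a contraction. -/
structure GraphConstants (l μ κ θ δ : ℝ) : Prop where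
  l_pos : 0 < l
  l_lt : l < 1
  lt_μ : 1 < μ
  κ_pos : 0 < κ
  κ_le_l : κ ≤ l / 2
  κ_le_gap : κ ≤ (1 - l) / 4
  κ_le_μ : κ ≤ (μ - 1) / 8
  θ_pos : 0 < θ
  θ_le : θ ≤ κ * (1 - l) / 8
  δ_pos : 0 < δ
  δ_le : δ ≤ κ

section

variable {l μ κ θ δ ε : ℝ} {g : ℝ × ℝ → ℝ} {u v : ℝ → ℝ}

lemma GraphConstants.θ_le_κ (hc : GraphConstants l μ κ θ δ) : θ ≤ κ := by
  nlinarith [hc.θ_le, hc.κ_pos, hc.l_pos]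

lemma SectorGraph.mem (hu : SectorGraph κ δ ε u) {x : ℝ} (hx : x ∈ Icc 0 ε) :
    (x, u x) ∈ stableSector δ ε := ⟨hx.1, hx.2, hu.1 x hx⟩

lemma SectorGraph.base_le (hc : GraphConstants l μ κ θ δ) (hu : SectorGraph κ δ ε u) {x : ℝ}
    (hx : x ∈ Icc 0 ε) : l / 2 * x ≤ l * x + u x ∧ l * x + u x ≤ (1 + l) / 2 * x := by
  have h1 := abs_le.1 (hu.1 x hx)
  have h2 := hc.δ_le
  have h3 := hc.κ_le_l
  have h4 := hc.κ_le_gap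
  have h5 := hc.l_lt
  have h0 := hx.1
  constructor <;> nlinarith

lemma SectorGraph.base_mem (hc : GraphConstants l μ κ θ δ) (hu : SectorGraph κ δ ε u) {x : ℝ}
    (hx : x ∈ Icc 0 ε) : l * x + u x ∈ Icc 0 ε := by
  have h1 := hu.base_le hc hx
  have h5 := hc.l_lt
  have h6 := hc.l_pos
  have h0 := hx.1
  have := hx.2
  constructor <;> nlinarith

lemma SectorGraph.abs_base_sub_le (hc : GraphConstants l μ κ θ δ) (hu : SectorGraph κ δ ε u)
    {x y : ℝ} (hx : x ∈ Icc 0 ε) (hy : y ∈ Icc 0 ε) :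
    |l * x + u x - (l * y + u y)| ≤ (l + κ) * |x - y| := by
  rw [show l * x + u x - (l * y + u y) = l * (x - y) + (u x - u y) by ring]
  refine (abs_add_le _ _).trans ?_
  rw [abs_mul, abs_of_pos hc.l_pos]
  linarith [hu.2 x hx y hy]

lemma SectorGraph.graphTransform (hc : GraphConstants l μ κ θ δ) (hg : SectorLipschitz g θ δ ε)
    (hg0 : ∀ x ∈ Icc 0 ε, |g (x, 0)| ≤ θ * δ * x) (hu : SectorGraph κ δ ε u) :
    SectorGraph κ δ ε (graphTransform l μ g u) := by
  have hμ : 0 < μ := by linarith [hc.lt_μ]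
  have hlt := hc.lt_μ
  have hδ := hc.δ_pos
  have hκ := hc.κ_pos
  have hθκ := hc.θ_le_κ
  have hθ := hc.θ_le
  have hθ0 := hc.θ_pos
  have hl := hc.l_lt
  have hl0 := hc.l_pos
  have hgap := hc.κ_le_gap
  refine ⟨fun x hx => ?_, fun x hx y hy => ?_⟩
  · rw [_root_.graphTransform, abs_div, abs_of_pos hμ, div_le_iff₀ hμ]
    have h1 := hu.1 _ (hu.base_mem hc hx)
    have h2 := (hu.base_le hc hx).2
    have h3 := hg _ (hu.mem hx) (x, 0) ⟨hx.1, hx.2, by simpa using mul_nonneg hδ.le hx.1⟩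
    have h4 := hg0 x hx
    have h5 := hu.1 x hx
    simp only [sub_self, abs_zero, zero_add, sub_zero] at h3
    have h6 : |g (x, u x)| ≤ |g (x, u x) - g (x, 0)| + |g (x, 0)| := by
      simpa using abs_add_le (g (x, u x) - g (x, 0)) (g (x, 0))
    have h7 : θ * |u x| ≤ θ * (δ * x) := by gcongr
    have h8 : δ * (l * x + u x) ≤ δ * ((1 + l) / 2 * x) := by gcongr
    have h9 : θ * (δ * x) ≤ (1 - l) / 8 * (δ * x) := by
      have := mul_nonneg hδ.le hx.1
      gcongr
      nlinarith
    have h10 : 0 ≤ δ * x := mul_nonneg hδ.le hx.1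
    have h11 := abs_sub (u (l * x + u x)) (g (x, u x))
    nlinarith
  · rw [_root_.graphTransform, _root_.graphTransform, ← sub_div, abs_div, abs_of_pos hμ,
      div_le_iff₀ hμ]
    have h1 := hu.2 _ (hu.base_mem hc hx) _ (hu.base_mem hc hy)
    have h3 := hg _ (hu.mem hx) _ (hu.mem hy)
    have h5 := hu.2 x hx y hy
    simp only at h3
    have h6 := hu.abs_base_sub_le hc hx hy
    have h7 : κ * |l * x + u x - (l * y + u y)| ≤ κ * ((l + κ) * |x - y|) := by gcongr
    have h8 : θ * (|x - y| + |u x - u y|) ≤ κ * (1 - l) / 8 * (|x - y| + |x - y|) := by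
      have : κ * |x - y| ≤ 1 * |x - y| := by gcongr; linarith
      exact mul_le_mul hθ (by linarith) (by positivity) (hθ0.le.trans hθ)
    have h11 := abs_sub (u (l * x + u x) - u (l * y + u y)) (g (x, u x) - g (y, u y))
    rw [show u (l * x + u x) - g (x, u x) - (u (l * y + u y) - g (y, u y)) =
      u (l * x + u x) - u (l * y + u y) - (g (x, u x) - g (y, u y)) by ring]
    have h12 : κ * ((l + κ) * |x - y|) + κ * (1 - l) / 8 * (|x - y| + |x - y|) ≤ κ * |x - y| := by
      have : 0 ≤ κ * |x - y| := by positivity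
      nlinarith
    have : 0 ≤ κ * |x - y| := by positivity
    nlinarith

lemma abs_graphTransform_sub_le (hc : GraphConstants l μ κ θ δ) (hg : SectorLipschitz g θ δ ε)
    (hu : SectorGraph κ δ ε u) (hv : SectorGraph κ δ ε v) {B : ℝ}
    (hB : ∀ x ∈ Icc 0 ε, |u x - v x| ≤ B) {x : ℝ} (hx : x ∈ Icc 0 ε) :
    |graphTransform l μ g u x - graphTransform l μ g v x| ≤ (1 + 2 * κ) / μ * B := by
  have hμ : 0 < μ := by linarith [hc.lt_μ]
  have hθ0 := hc.θ_pos
  have hκ := hc.κ_pos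
  have hθκ := hc.θ_le_κ
  rw [graphTransform, graphTransform, ← sub_div, abs_div, abs_of_pos hμ, div_mul_eq_mul_div]
  gcongr
  have h1 := hB _ (hu.base_mem hc hx)
  have h2 := hv.2 _ (hu.base_mem hc hx) _ (hv.base_mem hc hx)
  have h3 := hg _ (hu.mem hx) _ (hv.mem hx)
  have h4 := hB _ hx
  simp only [sub_self, abs_zero, zero_add, add_sub_add_left_eq_sub] at h2 h3
  have h5 : κ * |u x - v x| ≤ κ * B := by gcongr
  have h6 : θ * |u x - v x| ≤ κ * B := by gcongr
  rw [show u (l * x + u x) - g (x, u x) - (v (l * x + v x) - g (x, v x)) =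
    (u (l * x + u x) - v (l * x + u x)) + (v (l * x + u x) - v (l * x + v x)) -
      (g (x, u x) - g (x, v x)) by ring]
  have h7 := abs_sub ((u (l * x + u x) - v (l * x + u x)) + (v (l * x + u x) - v (l * x + v x)))
      (g (x, u x) - g (x, v x))
  have h8 := abs_add_le (u (l * x + u x) - v (l * x + u x)) (v (l * x + u x) - v (l * x + v x))
  linarith

lemma GraphConstants.ratio_lt_one (hc : GraphConstants l μ κ θ δ) : (1 + 2 * κ) / μ < 1 := by
  rw [div_lt_one (by linarith [hc.lt_μ])]
  linarith [hc.κ_le_μ, hc.lt_μ]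

lemma GraphConstants.ratio_nonneg (hc : GraphConstants l μ κ θ δ) : 0 ≤ (1 + 2 * κ) / μ := by
  have := hc.lt_μ
  have := hc.κ_pos
  positivity

lemma SectorGraph.eqOn_of_fixed (hc : GraphConstants l μ κ θ δ) (hg : SectorLipschitz g θ δ ε)
    (hu : SectorGraph κ δ ε u) (hv : SectorGraph κ δ ε v)
    (hfu : ∀ x ∈ Icc 0 ε, _root_.graphTransform l μ g u x = u x)
    (hfv : ∀ x ∈ Icc 0 ε, _root_.graphTransform l μ g v x = v x) : EqOn u v (Icc 0 ε) := by
  have key : ∀ n : ℕ, ∀ x ∈ Icc 0 ε, |u x - v x| ≤ ((1 + 2 * κ) / μ) ^ n * (2 * δ * ε) := by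
    intro n
    induction n with
    | zero =>
      intro x hx
      have h1 := hu.1 x hx
      have h2 := hv.1 x hx
      have h3 := abs_sub (u x) (v x)
      have h4 : δ * x ≤ δ * ε := by have := hc.δ_pos; gcongr; exact hx.2
      linarith
    | succ n ih =>
      intro x hx
      rw [← hfu x hx, ← hfv x hx, pow_succ', mul_assoc]
      exact abs_graphTransform_sub_le hc hg hu hv ih hx
  intro x hx
  have ht : Tendsto (fun n : ℕ => ((1 + 2 * κ) / μ) ^ n * (2 * δ * ε)) atTop (𝓝 0) := by
    simpa using (tendsto_pow_atTop_nhds_zero_of_lt_one hc.ratio_nonneg hc.ratio_lt_one).mul_const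
      (2 * δ * ε)
  have := ge_of_tendsto' ht fun n => key n x hx
  exact sub_eq_zero.1 (abs_nonpos_iff.1 this)

lemma exists_sectorGraph_fixed (hc : GraphConstants l μ κ θ δ) (hg : SectorLipschitz g θ δ ε)
    (hg0 : ∀ x ∈ Icc 0 ε, |g (x, 0)| ≤ θ * δ * x) :
    ∃ u, SectorGraph κ δ ε u ∧ ∀ x ∈ Icc 0 ε, graphTransform l μ g u x = u x := by
  have hδ := hc.δ_pos
  have hκ := hc.κ_pos
  set U : ℕ → ℝ → ℝ := fun n => (graphTransform l μ g)^[n] 0 with hU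
  have hUs : ∀ n, U (n + 1) = graphTransform l μ g (U n) := fun n =>
    Function.iterate_succ_apply' _ _ _
  have hUg : ∀ n, SectorGraph κ δ ε (U n) := by
    intro n
    induction n with
    | zero =>
      refine ⟨fun x hx => ?_, fun x hx y hy => ?_⟩
      · simpa [hU] using mul_nonneg hδ.le hx.1
      · simp only [hU, Function.iterate_zero, id_eq, Pi.zero_apply, sub_self, abs_zero]
        positivity
    | succ n ih => rw [hUs]; exact ih.graphTransform hc hg hg0
  have hdist : ∀ n : ℕ, ∀ x ∈ Icc 0 ε,
      |U n x - U (n + 1) x| ≤ ((1 + 2 * κ) / μ) ^ n * (δ * ε) := by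
    intro n
    induction n with
    | zero =>
      intro x hx
      have h1 := (hUg 1).1 x hx
      have h4 : δ * x ≤ δ * ε := by gcongr; exact hx.2
      have : U 0 x = 0 := rfl
      simp only [this, zero_add, zero_sub, abs_neg, pow_zero, one_mul]
      linarith
    | succ n ih =>
      intro x hx
      rw [hUs n, hUs (n + 1), pow_succ', mul_assoc]
      exact abs_graphTransform_sub_le hc hg (hUg n) (hUg (n + 1)) ih hx
  have hlim : ∀ x ∈ Icc 0 ε, ∃ y, Tendsto (fun n => U n x) atTop (𝓝 y) := by
    intro x hx
    refine cauchySeq_tendsto_of_complete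
      (cauchySeq_of_le_geometric _ (δ * ε) hc.ratio_lt_one fun n => ?_)
    rw [Real.dist_eq, mul_comm]
    exact hdist n x hx
  choose! u hu using hlim
  have hug : SectorGraph κ δ ε u := by
    refine ⟨fun x hx => ?_, fun x hx y hy => ?_⟩
    · exact le_of_tendsto' (hu x hx).abs fun n => (hUg n).1 x hx
    · exact le_of_tendsto' ((hu x hx).sub (hu y hy)).abs fun n => (hUg n).2 x hx y hy
  refine ⟨u, hug, fun x hx => ?_⟩
  have h1 : Tendsto (fun n => U n (l * x + U n x)) atTop (𝓝 (u (l * x + u x))) := by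
    have hd : Tendsto (fun n => U n (l * x + U n x) - U n (l * x + u x)) atTop (𝓝 0) := by
      refine squeeze_zero_norm (a := fun n => κ * |U n x - u x|) (fun n => ?_) ?_
      · have := (hUg n).2 _ ((hUg n).base_mem hc hx) _ (hug.base_mem hc hx)
        simpa using this
      · have := (((hu x hx).sub_const (u x)).abs).const_mul κ
        simpa using this
    simpa using hd.add (hu _ (hug.base_mem hc hx))
  have h2 : Tendsto (fun n => g (x, U n x)) atTop (𝓝 (g (x, u x))) := by
    rw [tendsto_iff_norm_sub_tendsto_zero]
    refine squeeze_zero (fun n => norm_nonneg _) (g := fun n => θ * |U n x - u x|) (fun n => ?_) ?_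
    · have := hg _ ((hUg n).mem hx) _ (hug.mem hx)
      simpa using this
    · have := (((hu x hx).sub_const (u x)).abs).const_mul θ
      simpa using this
  have h3 := (h1.sub h2).div_const μ
  refine tendsto_nhds_unique h3 ?_
  have h4 := (tendsto_add_atTop_iff_nat 1).2 (hu x hx)
  refine h4.congr fun n => ?_
  rw [hUs]; rfl

end

lemma abs_sub_le_of_hasDerivWithinAt {u : ℝ → ℝ} {s : Set ℝ} {x₀ x r d d' η : ℝ}
    (hd : ∀ x ∈ s, ∀ y ∈ s, |x - x₀| < r → |y - x₀| < r → |u x - u y - d * (x - y)| ≤ η * |x - y|)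
    (hs : UniqueDiffWithinAt ℝ s x) (hx : x ∈ s) (hxr : |x - x₀| < r)
    (hu : HasDerivWithinAt u d' s x) : |d' - d| ≤ η := by
  have : (𝓝[s \ {x}] x).NeBot := by
    have := uniqueDiffWithinAt_iff_accPt.1 hs
    rwa [accPt_principal_iff_nhdsWithin] at this
  have ht := ((hasDerivWithinAt_iff_tendsto_slope.1 hu).sub_const d).abs
  refine le_of_tendsto ht ?_
  have hball : ∀ᶠ y in 𝓝[s \ {x}] x, |y - x₀| < r :=
    nhdsWithin_le_nhds ((continuous_id.sub continuous_const).abs.continuousAt.eventually_lt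
      continuousAt_const hxr)
  filter_upwards [hball, self_mem_nhdsWithin] with y hy hys
  have hne : y - x ≠ 0 := sub_ne_zero.2 hys.2
  have h1 := hd y hys.1 x hx hy hxr
  rw [slope_def_field, show (u y - u x) / (y - x) - d = (u y - u x - d * (y - x)) / (y - x) by
    field_simp, abs_div]
  exact (div_le_iff₀ (abs_pos.2 hne)).2 h1

/-- A function whose difference quotients have zero oscillation at every point is `C¹`. -/
lemma contDiffOn_one_of_slope_oscillation {u : ℝ → ℝ} {s : Set ℝ} (hs : UniqueDiffOn ℝ s)
    (hu : ∀ x₀ ∈ s, ∀ η > 0, ∃ d, ∃ r > 0, ∀ x ∈ s, ∀ y ∈ s, |x - x₀| < r → |y - x₀| < r →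
      |u x - u y - d * (x - y)| ≤ η * |x - y|) : ContDiffOn ℝ 1 u s := by
  have hdiff : DifferentiableOn ℝ u s := by
    intro x hx
    have : (𝓝[s \ {x}] x).NeBot := by
      have := uniqueDiffWithinAt_iff_accPt.1 (hs x hx)
      rwa [accPt_principal_iff_nhdsWithin] at this
    have hC : Cauchy (map (slope u x) (𝓝[s \ {x}] x)) := by
      refine Metric.cauchy_iff.2 ⟨inferInstance, fun η hη => ?_⟩
      obtain ⟨d, r, hr, hd⟩ := hu x hx (η / 3) (by positivity)
      refine ⟨Metric.closedBall d (η / 3), ?_, fun a ha b hb => ?_⟩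
      · rw [mem_map]
        have hball : ∀ᶠ y in 𝓝[s \ {x}] x, |y - x| < r :=
          nhdsWithin_le_nhds (Metric.ball_mem_nhds x hr)
        filter_upwards [hball, self_mem_nhdsWithin] with y hy hys
        have hne : y - x ≠ 0 := sub_ne_zero.2 hys.2
        have h1 := hd y hys.1 x hx hy (by simpa using hr)
        rw [mem_preimage, Metric.mem_closedBall, Real.dist_eq, slope_def_field,
          show (u y - u x) / (y - x) - d = (u y - u x - d * (y - x)) / (y - x) by field_simp,
          abs_div]
        exact (div_le_iff₀ (abs_pos.2 hne)).2 h1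
      · have := dist_triangle_right a b d
        rw [Metric.mem_closedBall] at ha hb
        linarith
    obtain ⟨d, hd⟩ := CompleteSpace.complete hC
    exact (hasDerivWithinAt_iff_tendsto_slope.2 hd).differentiableWithinAt
  rw [contDiffOn_one_iff_derivWithin hs]
  refine ⟨hdiff, fun x₀ hx₀ => ?_⟩
  rw [Metric.continuousWithinAt_iff]
  intro η hη
  obtain ⟨d, r, hr, hd⟩ := hu x₀ hx₀ (η / 3) (by positivity)
  refine ⟨r, hr, fun x hx hxr => ?_⟩
  have h1 := abs_sub_le_of_hasDerivWithinAt hd (hs x hx) hx hxr (hdiff x hx).hasDerivWithinAt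
  have h2 := abs_sub_le_of_hasDerivWithinAt hd (hs x₀ hx₀) hx₀ (by simpa using hr)
    (hdiff x₀ hx₀).hasDerivWithinAt
  rw [Real.dist_eq]
  rw [abs_le] at h1 h2
  rw [abs_lt]
  constructor <;> linarith

section

variable {l μ κ θ δ ε : ℝ} {g : ℝ × ℝ → ℝ} {u : ℝ → ℝ}

lemma SectorGraph.abs_slope_le (hu : SectorGraph κ δ ε u) {x₀ d r : ℝ} (hx₀ : x₀ ∈ Ioo 0 ε)
    (hr : 0 < r)
    (hd : ∀ x ∈ Icc 0 ε, ∀ y ∈ Icc 0 ε, |x - x₀| < r → |y - x₀| < r →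
      |u x - u y - d * (x - y)| ≤ κ * |x - y|) : |d| ≤ 2 * κ := by
  have hpos : 0 < ε - x₀ := sub_pos.2 hx₀.2
  obtain ⟨t, ht0, htr, htε⟩ : ∃ t, 0 < t ∧ t < r ∧ t < ε - x₀ := by
    obtain ⟨t, ht0, ht⟩ := exists_between (lt_min hr hpos)
    exact ⟨t, ht0, ht.trans_le (min_le_left _ _), ht.trans_le (min_le_right _ _)⟩
  have hm : x₀ + t ∈ Icc 0 ε := ⟨by linarith [hx₀.1], by linarith⟩
  have hm₀ : x₀ ∈ Icc 0 ε := Ioo_subset_Icc_self hx₀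
  have h1 := hd _ hm _ hm₀ (by simpa [abs_of_pos ht0] using htr) (by simpa using hr)
  have h2 := hu.2 _ hm _ hm₀
  rw [add_sub_cancel_left, abs_of_pos ht0] at h1 h2
  have h3 : |d * t| ≤ 2 * κ * t := by
    rw [abs_le] at *
    constructor <;> linarith
  rw [abs_mul, abs_of_pos ht0] at h3
  exact le_of_mul_le_mul_right h3 ht0

lemma SectorGraph.slope_oscillation_le (hc : GraphConstants l μ κ θ δ) (hu : SectorGraph κ δ ε u)
    (hfix : ∀ x ∈ Icc 0 ε, u (l * x + u x) = μ * u x + g (x, u x))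
    (hg : ∀ p ∈ stableSector δ ε, 0 < p.1 →
      ∃ L : ℝ × ℝ →L[ℝ] ℝ, |L (0, 1)| ≤ θ ∧ HasStrictFDerivAt g L p) (n : ℕ) :
    ∀ x₀ ∈ Ioo 0 ε, ∃ d, ∃ r > 0, ∀ x ∈ Icc 0 ε, ∀ y ∈ Icc 0 ε, |x - x₀| < r → |y - x₀| < r →
      |u x - u y - d * (x - y)| ≤ κ * ((1 + l) / 2) ^ n * |x - y| := by
  have hκ := hc.κ_pos
  have hl0 := hc.l_pos
  have hl := hc.l_lt
  have hgap := hc.κ_le_gap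
  have hκμ := hc.κ_le_μ
  have hμ := hc.lt_μ
  have hθκ := hc.θ_le_κ
  induction n with
  | zero =>
    intro x₀ _
    refine ⟨0, 1, one_pos, fun x hx y hy _ _ => ?_⟩
    simpa using hu.2 x hx y hy
  | succ n ih =>
    intro x₀ hx₀
    have hm₀ : x₀ ∈ Icc 0 ε := Ioo_subset_Icc_self hx₀
    have hb := hu.base_le hc hm₀
    have hx₀pos := hx₀.1
    obtain ⟨d', r', hr', hd'⟩ := ih (l * x₀ + u x₀) ⟨by nlinarith, by nlinarith [hx₀.2]⟩
    set K := κ * ((1 + l) / 2) ^ n with hK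
    have hK0 : 0 < K := by positivity
    have hKκ : K ≤ κ := mul_le_of_le_one_right hκ.le (pow_le_one₀ (by positivity) (by linarith))
    have hd'κ : |d'| ≤ 2 * κ := by
      refine hu.abs_slope_le (x₀ := l * x₀ + u x₀) ⟨by nlinarith, by nlinarith [hx₀.2]⟩ hr' ?_
      intro x hx y hy hxr hyr
      exact (hd' x hx y hy hxr hyr).trans (by gcongr)
    obtain ⟨L, hLθ, hL⟩ := hg _ (hu.mem hm₀) hx₀pos
    have hη : 0 < (1 - l) / 4 * K := by have := sub_pos.2 hl; positivity
    obtain ⟨ρ, hρ, hLρ⟩ := Metric.eventually_nhds_iff.1 (hL.isLittleO.def hη)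
    have hLlin : ∀ a b, L (a, b) = L (1, 0) * a + L (0, 1) * b := by
      intro a b
      have : ((a, b) : ℝ × ℝ) = a • (1, 0) + b • (0, 1) := by simp
      rw [this, map_add, map_smul, map_smul, smul_eq_mul, smul_eq_mul]
      ring
    set a := L (1, 0)
    set b := L (0, 1)
    have hD : 1 ≤ μ - d' + b := by
      rw [abs_le] at hLθ hd'κ
      linarith
    refine ⟨(d' * l - a) / (μ - d' + b), min ρ r', lt_min hρ hr', fun x hx y hy hxr hyr => ?_⟩
    have hnear : ∀ z ∈ Icc 0 ε, |z - x₀| < min ρ r' →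
        dist (z, u z) (x₀, u x₀) < ρ ∧ |l * z + u z - (l * x₀ + u x₀)| < r' := by
      intro z hz hzr
      have h1 := hu.2 z hz x₀ hm₀
      have h2 : κ * |z - x₀| ≤ 1 * |z - x₀| := by gcongr; linarith
      have h3 := hu.abs_base_sub_le hc hz hm₀
      have h4 : (l + κ) * |z - x₀| ≤ 1 * |z - x₀| := by gcongr; linarith
      have h5 := lt_min_iff.1 hzr
      refine ⟨?_, by linarith [h5.2]⟩
      rw [Prod.dist_eq, max_lt_iff, Real.dist_eq, Real.dist_eq]
      exact ⟨h5.1, by linarith [h5.1]⟩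
    have h1 := hd' _ (hu.base_mem hc hx) _ (hu.base_mem hc hy) (hnear x hx hxr).2 (hnear y hy hyr).2
    have h2 := hLρ (y := ((x, u x), (y, u y)))
      (by rw [Prod.dist_eq]; exact max_lt (hnear x hx hxr).1 (hnear y hy hyr).1)
    have h3 : ‖((x, u x) : ℝ × ℝ) - (y, u y)‖ ≤ |x - y| := by
      rw [Prod.mk_sub_mk, Prod.norm_mk]
      refine max_le le_rfl ((hu.2 x hx y hy).trans ?_)
      exact mul_le_of_le_one_left (abs_nonneg _) (by linarith)
    replace h2 := h2.trans (mul_le_mul_of_nonneg_left h3 hη.le)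
    simp only [Prod.mk_sub_mk, hLlin, Real.norm_eq_abs] at h2
    replace h1 := h1.trans (mul_le_mul_of_nonneg_left (hu.abs_base_sub_le hc hx hy) hK0.le)
    rw [hfix x hx, hfix y hy] at h1
    have hDpos : 0 < μ - d' + b := by linarith
    rw [show u x - u y - (d' * l - a) / (μ - d' + b) * (x - y) =
      ((μ - d' + b) * (u x - u y) - (d' * l - a) * (x - y)) / (μ - d' + b) by field_simp,
      abs_div, abs_of_pos hDpos]
    refine (div_le_self (abs_nonneg _) hD).trans ?_
    have h4 : |(μ - d' + b) * (u x - u y) - (d' * l - a) * (x - y)| ≤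
        K * ((l + κ) * |x - y|) + (1 - l) / 4 * K * |x - y| := by
      rw [abs_le] at *
      constructor <;> linarith
    refine h4.trans ?_
    rw [pow_succ, ← mul_assoc κ, ← hK]
    have h5 : 0 ≤ K * |x - y| := by positivity
    nlinarith

/-- A planar map `(x, y) ↦ (l x + y, μ y + g (x, y))` with `0 < l < 1 < μ`, whose nonlinear part
has arbitrarily small Lipschitz constant on thin short sectors, has a `C¹` invariant graph tangent
to the first axis. -/
theorem exists_contDiffOn_invariant_graph (hl0 : 0 < l) (hl : l < 1) (hμ : 1 < μ) (hg0 : g 0 = 0)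
    (hg : ∀ θ > 0, ∃ δ > 0, ∃ ε > 0, SectorLipschitz g θ δ ε ∧
      ∀ p ∈ stableSector δ ε, 0 < p.1 →
        ∃ L : ℝ × ℝ →L[ℝ] ℝ, |L (0, 1)| ≤ θ ∧ HasStrictFDerivAt g L p) :
    ∃ ε > 0, ∃ u : ℝ → ℝ, ContDiffOn ℝ 1 u (Ico 0 ε) ∧ HasDerivWithinAt u 0 (Ico 0 ε) 0 ∧
      (∀ x ∈ Ico 0 ε, |u x| ≤ 1 / 4 * x) ∧
      (∀ x ∈ Ico 0 ε, l / 2 * x ≤ l * x + u x ∧ l * x + u x ≤ (1 + l) / 2 * x) ∧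
      ∀ x ∈ Ico 0 ε, u (l * x + u x) = μ * u x + g (x, u x) := by
  obtain ⟨κ₀, hκ₀, hκ₀l, hκ₀gap, hκ₀μ⟩ :
      ∃ κ₀ : ℝ, 0 < κ₀ ∧ κ₀ ≤ l / 2 ∧ κ₀ ≤ (1 - l) / 4 ∧ κ₀ ≤ (μ - 1) / 8 := by
    refine ⟨min (l / 2) (min ((1 - l) / 4) ((μ - 1) / 8)), ?_, min_le_left _ _,
      (min_le_right _ _).trans (min_le_left _ _), (min_le_right _ _).trans (min_le_right _ _)⟩
    refine lt_min (by linarith) (lt_min (by linarith) (by linarith))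
  have hlocal : ∀ κ, 0 < κ → κ ≤ κ₀ → ∀ δ₁ > 0, ∀ ε₁ > 0, ∃ θ δ ε, GraphConstants l μ κ θ δ ∧
      0 < ε ∧ δ ≤ δ₁ ∧ ε ≤ ε₁ ∧ SectorLipschitz g θ δ ε ∧
      (∀ p ∈ stableSector δ ε, 0 < p.1 →
        ∃ L : ℝ × ℝ →L[ℝ] ℝ, |L (0, 1)| ≤ θ ∧ HasStrictFDerivAt g L p) ∧
      ∃ u, SectorGraph κ δ ε u ∧ ∀ x ∈ Icc 0 ε, graphTransform l μ g u x = u x := by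
    intro κ hκ hκκ₀ δ₁ hδ₁ ε₁ hε₁
    have hθ : 0 < κ * (1 - l) / 8 := by have := sub_pos.2 hl; positivity
    obtain ⟨δ₂, hδ₂, ε₂, hε₂, hLip, hder⟩ := hg _ hθ
    set θ := κ * (1 - l) / 8 with hθdef
    set δ := min κ (min δ₁ δ₂) with hδdef
    have hδ : 0 < δ := lt_min hκ (lt_min hδ₁ hδ₂)
    obtain ⟨δ₃, hδ₃, ε₃, hε₃, hLip₃, -⟩ := hg (θ * δ) (by positivity)
    set ε := min ε₁ (min ε₂ ε₃) with hεdef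
    have hε : 0 < ε := lt_min hε₁ (lt_min hε₂ hε₃)
    have hc : GraphConstants l μ κ θ δ := ⟨hl0, hl, hμ, hκ, hκκ₀.trans hκ₀l, hκκ₀.trans hκ₀gap,
      hκκ₀.trans hκ₀μ, hθ, le_rfl, hδ, min_le_left _ _⟩
    have hsub : stableSector δ ε ⊆ stableSector δ₂ ε₂ := fun p hp =>
      ⟨hp.1, hp.2.1.trans ((min_le_right _ _).trans (min_le_left _ _)), hp.2.2.trans
        (mul_le_mul_of_nonneg_right ((min_le_right _ _).trans (min_le_right _ _)) hp.1)⟩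
    have hLip' : SectorLipschitz g θ δ ε := fun p hp q hq => hLip p (hsub hp) q (hsub hq)
    refine ⟨θ, δ, ε, hc, hε, (min_le_right _ _).trans (min_le_left _ _), min_le_left _ _, hLip',
      fun p hp => hder p (hsub hp), exists_sectorGraph_fixed hc hLip' fun x hx => ?_⟩
    have h := hLip₃ (x, 0)
      ⟨hx.1, hx.2.trans ((min_le_right _ _).trans (min_le_right _ _)), by
        simpa using mul_nonneg hδ₃.le hx.1⟩ (0, 0) ⟨le_rfl, hε₃.le, by simp⟩
    rw [show ((0, 0) : ℝ × ℝ) = 0 from rfl, hg0] at h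
    simpa [abs_of_nonneg hx.1] using h
  obtain ⟨θ, δ, ε, hc, hε, -, -, hLip, hder, u, hu, hfix⟩ := hlocal κ₀ hκ₀ le_rfl 1 one_pos 1 one_pos
  have hfix' : ∀ x ∈ Icc 0 ε, u (l * x + u x) = μ * u x + g (x, u x) := by
    intro x hx
    have h := hfix x hx
    rw [graphTransform, div_eq_iff (by linarith)] at h
    linarith
  have hsmall : ∀ η > 0, ∃ r > 0, ∀ x ∈ Icc 0 ε, ∀ y ∈ Icc 0 ε, |x - 0| < r → |y - 0| < r →
      |u x - u y - 0 * (x - y)| ≤ η * |x - y| := by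
    intro η hη
    obtain ⟨θ', δ', ε', hc', hε', hδδ', hεε', hLip', -, v, hv, hfixv⟩ :=
      hlocal (min η κ₀) (lt_min hη hκ₀) (min_le_right _ _) δ hc.δ_pos ε hε
    have hI : Icc 0 ε' ⊆ Icc 0 ε := Icc_subset_Icc_right hεε'
    have huε' : SectorGraph κ₀ δ ε' u :=
      ⟨fun x hx => hu.1 x (hI hx), fun x hx y hy => hu.2 x (hI hx) y (hI hy)⟩
    have hvε' : SectorGraph κ₀ δ ε' v :=
      ⟨fun x hx => (hv.1 x hx).trans (mul_le_mul_of_nonneg_right hδδ' hx.1),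
        fun x hx y hy => (hv.2 x hx y hy).trans (by gcongr; exact min_le_right _ _)⟩
    have hLipε' : SectorLipschitz g θ δ ε' := fun p hp q hq =>
      hLip p ⟨hp.1, hp.2.1.trans hεε', hp.2.2⟩ q ⟨hq.1, hq.2.1.trans hεε', hq.2.2⟩
    have heq := huε'.eqOn_of_fixed hc hLipε' hvε' (fun x hx => hfix x (hI hx)) hfixv
    refine ⟨ε', hε', fun x hx y hy hxr hyr => ?_⟩
    rw [sub_zero] at hxr hyr
    have hx' : x ∈ Icc 0 ε' := ⟨hx.1, (le_abs_self x).trans hxr.le⟩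
    have hy' : y ∈ Icc 0 ε' := ⟨hy.1, (le_abs_self y).trans hyr.le⟩
    rw [heq hx', heq hy', zero_mul, sub_zero]
    exact (hv.2 x hx' y hy').trans (by gcongr; exact min_le_left _ _)
  have hsub : Ico 0 ε ⊆ Icc 0 ε := Ico_subset_Icc_self
  have hunique : UniqueDiffOn ℝ (Ico 0 ε) := uniqueDiffOn_Ico 0 ε
  have h0 : (0 : ℝ) ∈ Ico 0 ε := ⟨le_rfl, hε⟩
  have hC : ContDiffOn ℝ 1 u (Ico 0 ε) := by
    refine contDiffOn_one_of_slope_oscillation hunique fun x₀ hx₀ η hη => ?_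
    rcases hx₀.1.eq_or_lt with rfl | hpos
    · obtain ⟨r, hr, h⟩ := hsmall η hη
      exact ⟨0, r, hr, fun x hx y hy => h x (hsub hx) y (hsub hy)⟩
    · have ht : Tendsto (fun n : ℕ => κ₀ * ((1 + l) / 2) ^ n) atTop (𝓝 0) := by
        simpa using (tendsto_pow_atTop_nhds_zero_of_lt_one (r := (1 + l) / 2) (by positivity)
          (by linarith)).const_mul κ₀
      obtain ⟨n, hn⟩ := (ht.eventually_lt_const hη).exists
      obtain ⟨d, r, hr, h⟩ := hu.slope_oscillation_le hc hfix' hder n x₀ ⟨hpos, hx₀.2⟩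
      refine ⟨d, r, hr, fun x hx y hy hxr hyr => (h x (hsub hx) y (hsub hy) hxr hyr).trans ?_⟩
      gcongr
  refine ⟨ε, hε, u, hC, ?_, fun x hx => (hu.1 x (hsub hx)).trans ?_,
    fun x hx => hu.base_le hc (hsub hx), fun x hx => hfix' x (hsub hx)⟩
  · have hd := ((hC.differentiableOn one_ne_zero) 0 h0).hasDerivWithinAt
    suffices hz : derivWithin u (Ico 0 ε) 0 = 0 by rwa [hz] at hd
    refine abs_nonpos_iff.1 (le_of_forall_pos_le_add fun η hη => ?_)
    obtain ⟨r, hr, h⟩ := hsmall η hη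
    have := abs_sub_le_of_hasDerivWithinAt (fun x hx y hy => h x (hsub hx) y (hsub hy))
      (hunique 0 h0) h0 (by simpa using hr) hd
    simpa using this
  · exact mul_le_mul_of_nonneg_right (by linarith [hc.δ_le]) hx.1

end

lemma convex_stableSector_pos (δ ε : ℝ) : Convex ℝ {p ∈ stableSector δ ε | 0 < p.1} := by
  rintro p ⟨⟨hp1, hp2, hp3⟩, hp⟩ q ⟨⟨hq1, hq2, hq3⟩, hq⟩ a b ha hb hab
  have hpos : 0 < a * p.1 + b * q.1 := by
    rcases ha.eq_or_lt with rfl | ha'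
    · have : b = 1 := by linarith
      simpa [this] using hq
    · have := mul_pos ha' hp
      have := mul_nonneg hb hq1
      linarith
  refine ⟨⟨hpos.le, ?_, ?_⟩, hpos⟩
  · have h1 := mul_le_mul_of_nonneg_left hp2 ha
    have h2 := mul_le_mul_of_nonneg_left hq2 hb
    calc a * p.1 + b * q.1 ≤ a * ε + b * ε := add_le_add h1 h2
      _ = ε := by rw [← add_mul, hab, one_mul]
  · have h1 := mul_le_mul_of_nonneg_left hp3 ha
    have h2 := mul_le_mul_of_nonneg_left hq3 hb
    calc |a * p.2 + b * q.2| ≤ |a * p.2| + |b * q.2| := abs_add_le _ _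
      _ = a * |p.2| + b * |q.2| := by rw [abs_mul, abs_mul, abs_of_nonneg ha, abs_of_nonneg hb]
      _ ≤ δ * (a * p.1 + b * q.1) := by linarith

lemma stableSector_subset_closure {δ ε : ℝ} (hδ : 0 ≤ δ) (hε : 0 < ε) :
    stableSector δ ε ⊆ closure {p ∈ stableSector δ ε | 0 < p.1} := by
  intro p hp
  rcases hp.1.eq_or_lt with h0 | hpos
  · have hp0 : p = 0 := by
      have := hp.2.2
      rw [← h0, mul_zero, abs_nonpos_iff] at this
      exact Prod.ext h0.symm this
    rw [hp0]
    have ht : Tendsto (fun t : ℝ => ((t, 0) : ℝ × ℝ)) (𝓝[>] 0) (𝓝 0) :=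
      ((by fun_prop : Continuous fun t : ℝ => ((t, 0) : ℝ × ℝ)).tendsto' 0 0 rfl).mono_left
        nhdsWithin_le_nhds
    refine mem_closure_of_tendsto ht ?_
    filter_upwards [Ioo_mem_nhdsGT hε] with t ht
    exact ⟨⟨ht.1.le, ht.2.le, by simpa using mul_nonneg hδ ht.1.le⟩, ht.1⟩
  · exact subset_closure ⟨hp, hpos⟩

lemma SectorLipschitz.of_hasFDerivAt {g : ℝ × ℝ → ℝ} {θ δ ε : ℝ} (hθ : 0 ≤ θ) (hδ : 0 ≤ δ)
    (hε : 0 < ε) (hcont : Continuous g)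
    (hg : ∀ p ∈ stableSector δ ε, 0 < p.1 → ∃ L : ℝ × ℝ →L[ℝ] ℝ, ‖L‖ ≤ θ ∧ HasFDerivAt g L p) :
    SectorLipschitz g θ δ ε := by
  choose! L hLθ hL using hg
  have hD : LipschitzOnWith ⟨θ, hθ⟩ g {p ∈ stableSector δ ε | 0 < p.1} :=
    (convex_stableSector_pos δ ε).lipschitzOnWith_of_nnnorm_hasFDerivWithin_le
      (fun p hp => (hL p hp.1 hp.2).hasFDerivWithinAt) fun p hp => hLθ p hp.1 hp.2
  have hcl := hD.closure hcont.continuousOn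
  intro p hp q hq
  have h := hcl.dist_le_mul p (stableSector_subset_closure hδ hε hp) q
    (stableSector_subset_closure hδ hε hq)
  rw [Real.dist_eq] at h
  refine h.trans (mul_le_mul_of_nonneg_left ?_ hθ)
  rw [Prod.dist_eq, Real.dist_eq, Real.dist_eq]
  exact max_le_add_of_nonneg (abs_nonneg _) (abs_nonneg _)

/-- A quadratic form on the plane with its derivative. -/
lemma hasStrictFDerivAt_quadratic (A B C : ℝ) (p : ℝ × ℝ) :
    HasStrictFDerivAt (fun p : ℝ × ℝ => A * p.1 ^ 2 + B * (p.1 * p.2) + C * p.2 ^ 2)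
      ((2 * A * p.1 + B * p.2) • ContinuousLinearMap.fst ℝ ℝ ℝ +
        (B * p.1 + 2 * C * p.2) • ContinuousLinearMap.snd ℝ ℝ ℝ) p := by
  have h1 : HasStrictFDerivAt (fun p : ℝ × ℝ => p.1) _ p := hasStrictFDerivAt_fst (𝕜 := ℝ)
  have h2 : HasStrictFDerivAt (fun p : ℝ × ℝ => p.2) _ p := hasStrictFDerivAt_snd (𝕜 := ℝ)
  have h := (((h1.pow 2).const_mul A).add ((h1.mul h2).const_mul B)).add ((h2.pow 2).const_mul C)
  refine h.congr_fderiv ?_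
  ext <;> simp <;> ring

lemma norm_le_abs_add_abs (L : ℝ × ℝ →L[ℝ] ℝ) : ‖L‖ ≤ |L (1, 0)| + |L (0, 1)| := by
  refine L.opNorm_le_bound (by positivity) fun v => ?_
  have hv : v = v.1 • (1, 0) + v.2 • (0, 1) := by ext <;> simp
  have h1 : |v.1| ≤ ‖v‖ := norm_fst_le v
  have h2 : |v.2| ≤ ‖v‖ := norm_snd_le v
  calc ‖L v‖ = |v.1 * L (1, 0) + v.2 * L (0, 1)| := by
        conv_lhs => rw [hv]
        rw [map_add, map_smul, map_smul]; rfl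
    _ ≤ |v.1| * |L (1, 0)| + |v.2| * |L (0, 1)| := by
        rw [← abs_mul, ← abs_mul]; exact abs_add_le _ _
    _ ≤ ‖v‖ * |L (1, 0)| + ‖v‖ * |L (0, 1)| := by gcongr
    _ = _ := by ring

/-- The square root of a quadratic form with a higher-order perturbation is, on thin short sectors,
close in the Lipschitz sense to its linearization along the positive first axis. -/
lemma sqrt_quadratic_sector_estimate {ν b C : ℝ} (hν : 0 < ν) {P : ℝ × ℝ → ℝ}
    (hPdiff : ContDiff ℝ 1 P)
    (hP : ∀ c > 0, ∃ ρ > 0, ∀ p, ‖p‖ < ρ → ‖fderiv ℝ P p‖ ≤ c * ‖p‖ ∧ |P p| ≤ c * ‖p‖ ^ 2)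
    {g : ℝ × ℝ → ℝ}
    (hg : ∀ p, g p = √(ν ^ 2 * p.1 ^ 2 + 2 * ν * b * (p.1 * p.2) + C * p.2 ^ 2 + P p) -
      (ν * p.1 + b * p.2)) :
    ∀ θ > 0, ∃ δ > 0, ∃ ε > 0, SectorLipschitz g θ δ ε ∧ ∀ p ∈ stableSector δ ε, 0 < p.1 →
      ∃ L : ℝ × ℝ →L[ℝ] ℝ, |L (0, 1)| ≤ θ ∧ HasStrictFDerivAt g L p := by
  intro θ hθ
  let rad : ℝ × ℝ × ℝ → ℝ := fun z => ν ^ 2 + 2 * ν * b * z.1 + C * z.1 ^ 2 + z.2.2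
  have hrad0 : rad 0 = ν ^ 2 := by simp [rad]
  have hradc : Continuous rad := by fun_prop
  have hsq0 : √(rad 0) = ν := by rw [hrad0, Real.sqrt_sq hν.le]
  have hev1 : ∀ᶠ z in 𝓝 (0 : ℝ × ℝ × ℝ), 0 < rad z :=
    hradc.continuousAt.eventually_const_lt (by rw [hrad0]; positivity)
  have hev2 : ∀ᶠ z in 𝓝 (0 : ℝ × ℝ × ℝ),
      |(2 * ν ^ 2 + 2 * ν * b * z.1 + z.2.1) / (2 * √(rad z)) - ν| < θ / 2 := by
    have hc : ContinuousAt (fun z : ℝ × ℝ × ℝ =>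
        |(2 * ν ^ 2 + 2 * ν * b * z.1 + z.2.1) / (2 * √(rad z)) - ν|) 0 := by
      refine ContinuousAt.abs (ContinuousAt.sub (ContinuousAt.div ?_ ?_ ?_) continuousAt_const)
      · fun_prop
      · fun_prop
      · rw [hsq0]; positivity
    refine hc.eventually_lt_const ?_
    beta_reduce
    rw [hsq0]
    have : (2 * ν ^ 2 + 2 * ν * b * (0 : ℝ × ℝ × ℝ).1 + (0 : ℝ × ℝ × ℝ).2.1) / (2 * ν) - ν = 0 := by
      simp; field_simp; ring
    rw [this, abs_zero]; positivity
  have hev3 : ∀ᶠ z in 𝓝 (0 : ℝ × ℝ × ℝ),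
      |(2 * ν * b + 2 * C * z.1 + z.2.1) / (2 * √(rad z)) - b| < θ / 2 := by
    have hc : ContinuousAt (fun z : ℝ × ℝ × ℝ =>
        |(2 * ν * b + 2 * C * z.1 + z.2.1) / (2 * √(rad z)) - b|) 0 := by
      refine ContinuousAt.abs (ContinuousAt.sub (ContinuousAt.div ?_ ?_ ?_) continuousAt_const)
      · fun_prop
      · fun_prop
      · rw [hsq0]; positivity
    refine hc.eventually_lt_const ?_
    beta_reduce
    rw [hsq0]
    have : (2 * ν * b + 2 * C * (0 : ℝ × ℝ × ℝ).1 + (0 : ℝ × ℝ × ℝ).2.1) / (2 * ν) - b = 0 := by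
      simp; field_simp; ring
    rw [this, abs_zero]; positivity
  obtain ⟨τ, hτ, hz⟩ := Metric.eventually_nhds_iff.1 (hev1.and (hev2.and hev3))
  obtain ⟨ρ, hρ, hPρ⟩ := hP (τ / 2) (by positivity)
  set δ := min 1 (τ / 2) with hδdef
  have hδ : 0 < δ := lt_min one_pos (by positivity)
  have hder : ∀ p ∈ stableSector δ (ρ / 2), 0 < p.1 → ∃ L : ℝ × ℝ →L[ℝ] ℝ,
      |L (1, 0)| ≤ θ / 2 ∧ |L (0, 1)| ≤ θ / 2 ∧ HasStrictFDerivAt g L p := by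
    rintro ⟨x, y⟩ ⟨-, hxρ, hyx⟩ hx
    simp only at hx hxρ hyx
    have hyδ : |y| ≤ x := hyx.trans (mul_le_of_le_one_left hx.le (min_le_left _ _))
    have hnorm : ‖((x, y) : ℝ × ℝ)‖ = x := by
      rw [Prod.norm_mk, Real.norm_eq_abs, Real.norm_eq_abs, abs_of_pos hx, max_eq_left hyδ]
    obtain ⟨hP1, hP2⟩ := hPρ (x, y) (by rw [hnorm]; linarith)
    rw [hnorm] at hP1 hP2
    have hvec : ∀ w : ℝ × ℝ, ‖w‖ ≤ 1 → |fderiv ℝ P (x, y) w / x| < τ := by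
      intro w hw
      rw [abs_div, abs_of_pos hx, div_lt_iff₀ hx]
      have h1 : |fderiv ℝ P (x, y) w| ≤ ‖fderiv ℝ P (x, y)‖ := by
        refine ((fderiv ℝ P (x, y)).le_opNorm w).trans ?_
        exact mul_le_of_le_one_right (norm_nonneg _) hw
      nlinarith [mul_pos hτ hx]
    have hball : ∀ w : ℝ × ℝ, ‖w‖ ≤ 1 →
        dist ((y / x, fderiv ℝ P (x, y) w / x, P (x, y) / x ^ 2) : ℝ × ℝ × ℝ) 0 < τ := by
      intro w hw
      rw [dist_zero_right, Prod.norm_mk, Prod.norm_mk]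
      refine max_lt ?_ (max_lt (hvec w hw) ?_)
      · rw [Real.norm_eq_abs, abs_div, abs_of_pos hx, div_lt_iff₀ hx]
        have : δ * x ≤ τ / 2 * x := by gcongr; exact min_le_right _ _
        nlinarith [mul_pos hτ hx]
      · rw [Real.norm_eq_abs, abs_div, abs_of_pos (by positivity : 0 < x ^ 2),
          div_lt_iff₀ (by positivity)]
        nlinarith [mul_pos hτ (by positivity : 0 < x ^ 2)]
    have hS : ν ^ 2 * x ^ 2 + 2 * ν * b * (x * y) + C * y ^ 2 + P (x, y) =
        x ^ 2 * (ν ^ 2 + 2 * ν * b * (y / x) + C * (y / x) ^ 2 + P (x, y) / x ^ 2) := by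
      field_simp
    obtain ⟨hpos, hx1, -⟩ := hz (hball (1, 0) (by simp))
    obtain ⟨-, -, hx2⟩ := hz (hball (0, 1) (by simp))
    simp only [rad] at hpos hx1 hx2
    set ϱ := ν ^ 2 + 2 * ν * b * (y / x) + C * (y / x) ^ 2 + P (x, y) / x ^ 2 with hϱ
    have hsqrt : √(ν ^ 2 * x ^ 2 + 2 * ν * b * (x * y) + C * y ^ 2 + P (x, y)) = x * √ϱ := by
      rw [hS, Real.sqrt_mul (by positivity), Real.sqrt_sq hx.le]
    have hSd : HasStrictFDerivAt _ _ ((x, y) : ℝ × ℝ) :=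
      (hasStrictFDerivAt_quadratic (ν ^ 2) (2 * ν * b) C (x, y)).add
        (hPdiff.contDiffAt.hasStrictFDerivAt one_ne_zero)
    have hne : ν ^ 2 * x ^ 2 + 2 * ν * b * (x * y) + C * y ^ 2 + P (x, y) ≠ 0 := by
      rw [hS]; positivity
    have hlin : HasStrictFDerivAt (fun p : ℝ × ℝ => ν * p.1 + b * p.2) _ (x, y) :=
      (ν • ContinuousLinearMap.fst ℝ ℝ ℝ + b • ContinuousLinearMap.snd ℝ ℝ ℝ).hasStrictFDerivAt
    have hgd := (hSd.sqrt hne).sub hlin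
    have hs0 : 0 < √ϱ := Real.sqrt_pos.2 hpos
    refine ⟨_, ?_, ?_, hgd.congr_of_eventuallyEq (Eventually.of_forall fun p => (hg p).symm)⟩
    · refine le_of_eq_of_le (congrArg abs ?_) hx1.le
      simp [hsqrt]
      field_simp
    · refine le_of_eq_of_le (congrArg abs ?_) hx2.le
      simp [hsqrt]
      field_simp
  have hcont : Continuous g := by
    rw [show g = _ from funext hg]
    have := hPdiff.continuous
    fun_prop
  refine ⟨δ, hδ, ρ / 2, by positivity, ?_, fun p hp hpos => ?_⟩
  · refine SectorLipschitz.of_hasFDerivAt hθ.le hδ.le (by positivity) hcont fun p hp hpos => ?_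
    obtain ⟨L, h1, h2, hL⟩ := hder p hp hpos
    exact ⟨L, (norm_le_abs_add_abs L).trans (by linarith), hL.hasFDerivAt⟩
  · obtain ⟨L, h1, h2, hL⟩ := hder p hp hpos
    exact ⟨L, by linarith, hL⟩

lemma exists_ball_bounds_of_vanishing_jet {P : ℝ × ℝ → ℝ} (hP : ContDiff ℝ 2 P) (h0 : P 0 = 0)
    (h1 : fderiv ℝ P 0 = 0) (h2 : fderiv ℝ (fderiv ℝ P) 0 = 0) :
    ∀ c > 0, ∃ ρ > 0, ∀ p, ‖p‖ < ρ → ‖fderiv ℝ P p‖ ≤ c * ‖p‖ ∧ |P p| ≤ c * ‖p‖ ^ 2 := by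
  intro c hc
  have hd : HasFDerivAt (fderiv ℝ P) (0 : ℝ × ℝ →L[ℝ] ℝ × ℝ →L[ℝ] ℝ) 0 := by
    rw [← h2]
    exact ((hP.fderiv_right (m := 1) (by norm_num)).differentiable one_ne_zero 0).hasFDerivAt
  obtain ⟨ρ, hρ, h⟩ := Metric.eventually_nhds_iff.1 (hd.isLittleO.def hc)
  have hb : ∀ p, ‖p‖ < ρ → ‖fderiv ℝ P p‖ ≤ c * ‖p‖ := by
    intro p hp
    simpa [h1] using h (by simpa using hp)
  refine ⟨ρ, hρ, fun p hp => ⟨hb p hp, ?_⟩⟩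
  have hmv := (convex_closedBall (0 : ℝ × ℝ) ‖p‖).norm_image_sub_le_of_norm_fderiv_le (𝕜 := ℝ)
    (f := P) (C := c * ‖p‖) (fun x _ => hP.differentiable two_ne_zero x) (fun x hx => ?_)
    (x := 0) (y := p) (by simp) (by simp)
  · simpa [h0, pow_two, mul_assoc] using hmv
  · rw [mem_closedBall_zero_iff] at hx
    exact (hb x (hx.trans_lt hp)).trans (by gcongr)

lemma exists_ball_bounds_comp_clm {P : ℝ × ℝ → ℝ} (hPd : Differentiable ℝ P)
    (hP : ∀ c > 0, ∃ ρ > 0, ∀ p, ‖p‖ < ρ → ‖fderiv ℝ P p‖ ≤ c * ‖p‖ ∧ |P p| ≤ c * ‖p‖ ^ 2)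
    (T : ℝ × ℝ →L[ℝ] ℝ × ℝ) :
    ∀ c > 0, ∃ ρ > 0, ∀ p, ‖p‖ < ρ →
      ‖fderiv ℝ (fun q => P (T q)) p‖ ≤ c * ‖p‖ ∧ |P (T p)| ≤ c * ‖p‖ ^ 2 := by
  intro c hc
  set K := ‖T‖ + 1 with hK
  have hK0 : 0 < K := by positivity
  have hTK : ‖T‖ ≤ K := by linarith
  obtain ⟨ρ, hρ, h⟩ := hP (c / K ^ 2) (by positivity)
  refine ⟨ρ / K, by positivity, fun p hp => ?_⟩
  have hTp : ‖T p‖ ≤ K * ‖p‖ := (T.le_opNorm p).trans (by gcongr)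
  obtain ⟨h1, h2⟩ := h (T p) (hTp.trans_lt (by rwa [lt_div_iff₀' hK0] at hp))
  constructor
  · have hf : fderiv ℝ (fun q => P (T q)) p = (fderiv ℝ P (T p)).comp T :=
      ((hPd (T p)).hasFDerivAt.comp p T.hasFDerivAt).fderiv
    rw [hf]
    calc ‖(fderiv ℝ P (T p)).comp T‖ ≤ ‖fderiv ℝ P (T p)‖ * ‖T‖ :=
          ContinuousLinearMap.opNorm_comp_le _ _
      _ ≤ (c / K ^ 2 * (K * ‖p‖)) * K := by
          gcongr
          exact h1.trans (by gcongr)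
      _ = c * ‖p‖ := by field_simp
  · calc |P (T p)| ≤ c / K ^ 2 * ‖T p‖ ^ 2 := h2
      _ ≤ c / K ^ 2 * (K * ‖p‖) ^ 2 := by gcongr
      _ = c * ‖p‖ ^ 2 := by field_simp


/-- **Existence of the invariant chatter curve `β` for the full blown-up map.**
Let `0 < r < 1`, let `m₃ ∈ (1/2, 3/2)` be the root of `2rm = (m − 1/2)²(m + 3/2)`,
let `Q(σ, η) = r(2η² − 3ση) + (9/4)(η − σ/2)²`, and let `R` be a `C^∞` function
vanishing to third order at the origin.  Define
`h(σ, η) = (η − σ/2, √(Q(σ, η) + R(σ, η)))` where the radicand is nonnegative.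
Then there exist `ε > 0` and a `C¹` function `w : [0, ε) → ℝ` with `w(0) = 0`,
`w′(0) = m₃`, such that the curve `β = {(s, w(s)) : s ∈ [0, ε)}` lies in the domain
of `h`, is invariant under `h`, and every point of `β` converges to the origin
under iteration of `h`. -/
theorem invariant_curve_full_blowup (r m3 : ℝ) (hr0 : 0 < r) (hr1 : r < 1)
    (hm3 : m3 ∈ Set.Ioo (1 / 2 : ℝ) (3 / 2))
    (heq : 2 * r * m3 = (m3 - 1 / 2) ^ 2 * (m3 + 3 / 2))
    (Q : ℝ × ℝ → ℝ)
    (hQ : ∀ p : ℝ × ℝ,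
      Q p = r * (2 * p.2 ^ 2 - 3 * p.1 * p.2) + (9 / 4) * (p.2 - p.1 / 2) ^ 2)
    (R : ℝ × ℝ → ℝ) (hRsmooth : ContDiff ℝ (⊤ : ℕ∞) R)
    (hR0 : R (0, 0) = 0)
    (hR1 : fderiv ℝ R (0, 0) = 0)
    (hR2 : fderiv ℝ (fun p => fderiv ℝ R p) (0, 0) = 0)
    (h : ℝ × ℝ → ℝ × ℝ)
    (hh : ∀ p : ℝ × ℝ, h p = (p.2 - p.1 / 2, Real.sqrt (Q p + R p))) :
    ∃ ε : ℝ, 0 < ε ∧ ∃ w : ℝ → ℝ,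
      ContDiffOn ℝ 1 w (Set.Ico 0 ε) ∧
      w 0 = 0 ∧
      derivWithin w (Set.Ico 0 ε) 0 = m3 ∧
      (∀ s ∈ Set.Ico (0 : ℝ) ε, 0 ≤ Q (s, w s) + R (s, w s)) ∧
      h '' {p : ℝ × ℝ | ∃ s ∈ Set.Ico (0 : ℝ) ε, p = (s, w s)}
        ⊆ {p : ℝ × ℝ | ∃ s ∈ Set.Ico (0 : ℝ) ε, p = (s, w s)} ∧
      (∀ s ∈ Set.Ico (0 : ℝ) ε,
        Filter.Tendsto (fun n => h^[n] (s, w s)) Filter.atTop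
          (nhds ((0, 0) : ℝ × ℝ))) := by
  obtain ⟨hm1, hm2⟩ := hm3
  set l := m3 - 1 / 2 with hl
  have hl0 : 0 < l := by linarith
  have hl1 : l < 1 := by linarith
  have hm0 : 0 < m3 := by linarith
  set μ := (m3 + 3 / 2) ^ 2 / (4 * m3 ^ 2) with hμdef
  have hμ : 1 < μ := by
    rw [hμdef, one_lt_div (by positivity)]
    nlinarith
  have hr : r = l ^ 2 * (m3 + 3 / 2) / (2 * m3) := by
    field_simp
    linarith
  let T : ℝ × ℝ →L[ℝ] ℝ × ℝ := (ContinuousLinearMap.fst ℝ ℝ ℝ).prod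
    (ContinuousLinearMap.snd ℝ ℝ ℝ + m3 • ContinuousLinearMap.fst ℝ ℝ ℝ)
  have hT : ∀ x y, T (x, y) = (x, y + m3 * x) := fun x y => rfl
  have hR2' : ContDiff ℝ 2 R := contDiff_infty.1 hRsmooth 2
  have hquad : ∀ x y, Q (T (x, y)) = (m3 * l) ^ 2 * x ^ 2 +
      2 * (m3 * l) * (m3 + μ) * (x * y) + (2 * r + 9 / 4) * y ^ 2 := by
    intro x y
    rw [hT, hQ, hr, hμdef, hl]
    field_simp
    ring
  let g : ℝ × ℝ → ℝ := fun p => √((m3 * l) ^ 2 * p.1 ^ 2 +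
      2 * (m3 * l) * (m3 + μ) * (p.1 * p.2) + (2 * r + 9 / 4) * p.2 ^ 2 + R (T p)) -
      ((m3 * l) * p.1 + (m3 + μ) * p.2)
  have hg0 : g 0 = 0 := by
    have : R 0 = 0 := hR0
    simp [g, this]
  obtain ⟨ε, hε, u, huC, hu0, hu4, hbase, hfix⟩ :=
    exists_contDiffOn_invariant_graph hl0 hl1 hμ hg0
      (sqrt_quadratic_sector_estimate (by positivity) ((hR2'.comp T.contDiff).of_le one_le_two)
        (exists_ball_bounds_comp_clm (hR2'.differentiable two_ne_zero)
          (exists_ball_bounds_of_vanishing_jet hR2' hR0 hR1 hR2) T) fun _ => rfl)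
  have h0 : (0 : ℝ) ∈ Set.Ico 0 ε := ⟨le_rfl, hε⟩
  have hu00 : u 0 = 0 := by simpa using hu4 0 h0
  set w : ℝ → ℝ := fun s => m3 * s + u s with hw
  have hbase_mem : ∀ s ∈ Set.Ico 0 ε, l * s + u s ∈ Set.Ico 0 ε := by
    intro s hs
    have h1 := hbase s hs
    have h2 := hs.1
    have h3 := hs.2
    constructor <;> nlinarith
  have hwbound : ∀ s ∈ Set.Ico 0 ε, 1 / 4 * s ≤ w s ∧ w s ≤ 2 * s := by
    intro s hs
    have h1 := abs_le.1 (hu4 s hs)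
    have h2 := hs.1
    constructor <;> simp only [hw] <;> nlinarith
  have hsqrt : ∀ s ∈ Set.Ico 0 ε, √(Q (s, w s) + R (s, w s)) = w (l * s + u s) := by
    intro s hs
    have hTs : T (s, u s) = (s, w s) := by rw [hT, hw]; simp only [add_comm]
    have h1 := hfix s hs
    simp only [g] at h1
    rw [← hquad, hTs] at h1
    simp only [hw] at h1 ⊢
    rw [h1]
    ring
  have hmap : ∀ s ∈ Set.Ico 0 ε, h (s, w s) = (l * s + u s, w (l * s + u s)) := by
    intro s hs
    rw [hh, hsqrt s hs]
    simp only [hw, hl, Prod.mk.injEq, and_true]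
    ring
  refine ⟨ε, hε, w, ?_, by simp [hw, hu00], ?_, ?_, ?_, ?_⟩
  · exact (contDiff_const.mul contDiff_id).contDiffOn.add huC
  · have hd : HasDerivWithinAt w (m3 * 1 + 0) (Set.Ico 0 ε) 0 :=
      ((hasDerivWithinAt_id 0 _).const_mul m3).add hu0
    simpa using hd.derivWithin (uniqueDiffOn_Ico 0 ε 0 h0)
  · intro s hs
    rcases hs.1.eq_or_lt with rfl | hpos
    · rw [hQ]
      simp [hw, hu00, hR0]
    · have h1 := (hwbound _ (hbase_mem s hs)).1
      have h2 := (hbase s hs).1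
      have h3 : 0 < √(Q (s, w s) + R (s, w s)) := by
        rw [hsqrt s hs]
        nlinarith [mul_pos hl0 hpos]
      exact (Real.sqrt_pos.1 h3).le
  · rintro _ ⟨_, ⟨s, hs, rfl⟩, rfl⟩
    exact ⟨_, hbase_mem s hs, hmap s hs⟩
  · intro s hs
    have horbit : ∀ n : ℕ, ∃ x ∈ Set.Ico 0 ε, h^[n] (s, w s) = (x, w x) ∧
        x ≤ ((1 + l) / 2) ^ n * s := by
      intro n
      induction n with
      | zero => exact ⟨s, hs, rfl, by simp⟩
      | succ n ih =>
        obtain ⟨x, hx, hxe, hxle⟩ := ih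
        refine ⟨_, hbase_mem x hx, by rw [Function.iterate_succ_apply', hxe, hmap x hx], ?_⟩
        rw [pow_succ', mul_assoc]
        exact (hbase x hx).2.trans (by gcongr)
    choose x hx hxe hxle using horbit
    have hx0 : Filter.Tendsto x Filter.atTop (nhds 0) := by
      refine squeeze_zero (fun n => (hx n).1) hxle ?_
      simpa using (tendsto_pow_atTop_nhds_zero_of_lt_one (r := (1 + l) / 2) (by positivity)
        (by linarith)).mul_const s
    have hw0 : Filter.Tendsto (fun n => w (x n)) Filter.atTop (nhds 0) := by
      refine squeeze_zero (fun n => ?_) (fun n => (hwbound _ (hx n)).2)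
        (by simpa using hx0.const_mul 2)
      linarith [(hwbound _ (hx n)).1, (hx n).1]
    simp only [hxe]
    exact hx0.prodMk_nhds hw0
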